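/- For any C ≥ 1/2, 0 ≤ Δ ≤ 1, δ ∈ ℝ, ε > 0, and g ∈ ℤ[ω] with g ≡ 1 (mod 3): ∑_{c ∈ ℤ[ω], c ≡ 1 (mod 3), C < N(c) ≤ 2C} N(gcd(g, c))^Δ · N(c)^{−δ} ≪_{δ, ε} N(g)^ε C^{1−δ}. -/

import Mathlib

noncomputable section

open Complex

namespace CubicPaper

/-- `ω = e^{2πi/3}`. -/
def ωc : ℂ := Complex.exp (2 * Real.pi * Complex.I / 3)

/-- The ring of Eisenstein integers `ℤ[ω]`, realized as a subring of `ℂ`. -/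
def Eis : Subring ℂ := Subring.closure {ωc}

/-- `ω` as an Eisenstein integer. -/
def ωE : Eis := ⟨ωc, Subring.subset_closure (Set.mem_singleton _)⟩

/-- The ramified prime `λ = 1 + 2ω`. -/
def lam : Eis := 1 + 2 * ωE

/-- The norm `N(x) = |x|²`. -/
def Nm (x : Eis) : ℝ := Complex.normSq (x : ℂ)

/-- The norm as a natural number. -/
def NmN (x : Eis) : ℕ := ⌊Nm x⌋₊

/-- `Rep x` : `x` is the canonical generator `λ^k c`, `c ≡ 1 (mod 3)`, of a nonzero ideal;
nonzero ideals of `ℤ[ω]` are in bijection with elements satisfying `Rep`. -/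
def Rep (x : Eis) : Prop := ∃ (k : ℕ) (c : Eis), (3 : Eis) ∣ (c - 1) ∧ x = lam ^ k * c

/-- `ě(z) = e^{2πi(z + z̄)}`. -/
def eE (z : ℂ) : ℂ := Complex.exp (2 * Real.pi * Complex.I * (z + (starRingEnd ℂ) z))

/-- Characterizing axioms of the cubic residue symbol; `χ b a` denotes `(a/b)₃`
(the lower entry `b ≡ 1 (mod 3)` comes first). -/
structure IsCubicSymbol (χ : Eis → Eis → Eis) : Prop where
  one_bot : ∀ a, χ 1 a = 1
  mul_bot : ∀ b₁ b₂ a, (3 : Eis) ∣ (b₁ - 1) → (3 : Eis) ∣ (b₂ - 1) →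
    χ (b₁ * b₂) a = χ b₁ a * χ b₂ a
  prime_vals : ∀ π a, Prime π → (3 : Eis) ∣ (π - 1) →
    χ π a = 0 ∨ χ π a = 1 ∨ χ π a = ωE ∨ χ π a = ωE ^ 2
  prime_congr : ∀ π a, Prime π → (3 : Eis) ∣ (π - 1) →
    π ∣ (a ^ ((NmN π - 1) / 3) - χ π a)
  prime_eq_zero : ∀ π a, Prime π → (3 : Eis) ∣ (π - 1) → (χ π a = 0 ↔ π ∣ a)

/-- Characterizing axioms of the Möbius function on `ℤ[ω]`. -/
structure IsMoebius (μ : Eis → ℤ) : Prop where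
  isUnit : ∀ u : Eis, IsUnit u → μ u = 1
  prime_mul : ∀ p x, Prime p → ¬ p ∣ x → μ (p * x) = - μ x
  eq_zero : ∀ x : Eis, ¬ Squarefree x → μ x = 0

/-- The cubic Gauss sum `g₃(m, c) = ∑_{d mod c} χ_c(d) ě(md/c)`. -/
def g₃ (χ : Eis → Eis → Eis) (m c : Eis) : ℂ :=
  ∑ᶠ d : Eis ⧸ Ideal.span {c}, ((χ c d.out : Eis) : ℂ) * eE (((m * d.out : Eis) : ℂ) / (c : ℂ))

/-- The normalized cubic Gauss sum `g̃₃(m, c) = N(c)^{-1/2} g₃(m, c)`. -/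
def g₃n (χ : Eis → Eis → Eis) (m c : Eis) : ℂ :=
  ((Real.sqrt (Nm c) : ℂ))⁻¹ * g₃ χ m c

/-- Euler's totient on `ℤ[ω]`. -/
def phiE (b : Eis) : ℕ := Nat.card {x : Eis ⧸ Ideal.span {b} // IsUnit x}

/-- The kernel `Φ_j(y) = (1/2πi)∫_{(2)} (2π)^{-jw} y^{-w} (Γ(1/2+w)/Γ(1/2))^j dw/w`. -/
def Φ (j : ℕ) (y : ℝ) : ℂ :=
  (1 / (2 * Real.pi)) * ∫ t : ℝ,
    (2 * Real.pi : ℂ) ^ (-((j : ℂ) * (2 + t * Complex.I))) *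
    (y : ℂ) ^ (-(2 + t * Complex.I)) *
    (Complex.Gamma (1 / 2 + (2 + t * Complex.I)) / Complex.Gamma (1 / 2)) ^ j /
    (2 + t * Complex.I)

/-- `A₁(q)`, the sum appearing in the approximate functional equation for `L(1/2, χ_q)`. -/
def A₁ (χ : Eis → Eis → Eis) (q : Eis) : ℂ :=
  ∑' n : {x : Eis // Rep x},
    ((χ q n.1 : Eis) : ℂ) * (Nm n.1 : ℂ) ^ (-(1/2 : ℂ)) *
      Φ 1 (Nm n.1 / Real.sqrt (3 * Nm q))

/-- `A₂(q)`, the double sum appearing in the approximate functional equation for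
`|L(1/2, χ_q)|²`. -/
def A₂ (χ : Eis → Eis → Eis) (q : Eis) : ℂ :=
  ∑' p : {x : Eis // Rep x} × {x : Eis // Rep x},
    ((χ q p.1.1 : Eis) : ℂ) * (starRingEnd ℂ) ((χ q p.2.1 : Eis) : ℂ) *
      ((Nm p.1.1 * Nm p.2.1 : ℝ) : ℂ) ^ (-(1/2 : ℂ)) *
      Φ 2 (Nm p.1.1 * Nm p.2.1 / (3 * Nm q))

/-- `M_Y(q) = ∑_{𝔩² ∣ q, N(𝔩) ≤ Y} μ(𝔩)` (sum over nonzero ideals `𝔩`, i.e. over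
canonical generators). -/
def MY (μ : Eis → ℤ) (Y : ℝ) (q : Eis) : ℤ :=
  ∑ᶠ l ∈ {l : Eis | Rep l ∧ l ^ 2 ∣ q ∧ Nm l ≤ Y}, μ l

/-- `R_Y(q) = ∑_{𝔩² ∣ q, N(𝔩) > Y} μ(𝔩)`. -/
def RY (μ : Eis → ℤ) (Y : ℝ) (q : Eis) : ℤ :=
  ∑ᶠ l ∈ {l : Eis | Rep l ∧ l ^ 2 ∣ q ∧ Y < Nm l}, μ l

/-- The mollifier `𝓜(q) = ∑_𝔟 λ(𝔟) √N(𝔟) χ_q(𝔟)` attached to coefficients `lm`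
(supported on canonical generators of squarefree ideals coprime to 3). -/
def Moll (χ : Eis → Eis → Eis) (lm : Eis → ℂ) (q : Eis) : ℂ :=
  ∑ᶠ b : Eis, lm b * (Real.sqrt (Nm b) : ℂ) * ((χ q b : Eis) : ℂ)

/-- `𝒮_M(β; F) = ∑_{q ≡ 1 (9)} M_Y(q) β_q F(N(q)/X)`. -/
def SM (μ : Eis → ℤ) (Y X : ℝ) (F : ℝ → ℝ) (β : Eis → ℂ) : ℂ :=
  ∑ᶠ q ∈ {q : Eis | (9 : Eis) ∣ (q - 1)}, (MY μ Y q : ℂ) * β q * (F (Nm q / X) : ℂ)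

/-- `𝒮_R(|β|; F) = ∑_{q ≡ 1 (9)} |R_Y(q)| ‖β_q‖ F(N(q)/X)`. -/
def SR (μ : Eis → ℤ) (Y X : ℝ) (F : ℝ → ℝ) (β : Eis → ℂ) : ℝ :=
  ∑ᶠ q ∈ {q : Eis | (9 : Eis) ∣ (q - 1)}, |(RY μ Y q : ℝ)| * ‖β q‖ * F (Nm q / X)

/-- A test function: Schwartz (here: smooth), compactly supported in `(1,2)`,
with `0 ≤ F ≤ 1`. -/
structure IsTestFn (F : ℝ → ℝ) : Prop where
  smooth : ContDiff ℝ (⊤ : ℕ∞) F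
  supp : ∀ t, F t ≠ 0 → 1 < t ∧ t < 2
  nonneg : ∀ t, 0 ≤ F t
  le_one : ∀ t, F t ≤ 1

/-- `F̌(0) = ∫₀^∞ F(t) dt`. -/
def Fcheck0 (F : ℝ → ℝ) : ℝ := ∫ t in Set.Ioi (0:ℝ), F t

/-- `F̌'(0) = ∫₀^∞ F(t) log t dt`. -/
def Fcheck'0 (F : ℝ → ℝ) : ℝ := ∫ t in Set.Ioi (0:ℝ), F t * Real.log t

/-- The Dedekind zeta function of `ℚ(ω)` (at real `s > 1`). -/
def zetaK (s : ℝ) : ℝ := ∑' n : {x : Eis // Rep x}, (Nm n.1) ^ (-s)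

/-- Product of `f(N(𝔭))` over the prime ideals `𝔭 ∤ 3` of `ℤ[ω]`, i.e. over primes
`π ≡ 1 (mod 3)` (one in each associate class). -/
def primeProd (f : ℝ → ℝ) : ℝ :=
  ∏' π : {p : Eis // Prime p ∧ (3 : Eis) ∣ (p - 1)}, f (Nm π.1)

/-- Product of `f(N(𝔭))` over the prime ideals `𝔭 ∤ 3` dividing `x` (a finite product). -/
def primeDivProd (f : ℝ → ℝ) (x : Eis) : ℝ :=
  ∏ᶠ π ∈ {p : Eis | Prime p ∧ (3 : Eis) ∣ (p - 1) ∧ p ∣ x}, f (Nm π)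

/-- The Hecke `L`-series `∑_𝔫 χ_q(𝔫) N(𝔫)^{-s}` (convergent for `Re(s) > 1`). -/
def heckeSeries (χ : Eis → Eis → Eis) (q : Eis) (s : ℂ) : ℂ :=
  ∑' n : {x : Eis // Rep x}, ((χ q n.1 : Eis) : ℂ) * (Nm n.1 : ℂ) ^ (-s)

/-- `L` is the (unique) entire continuation of the Hecke `L`-series of `χ_q`. -/
def IsHeckeL (χ : Eis → Eis → Eis) (q : Eis) (L : ℂ → ℂ) : Prop :=
  Differentiable ℂ L ∧ ∀ s : ℂ, 1 < s.re → L s = heckeSeries χ q s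

/-- Membership in the family `F₃` of conductors of primitive cubic Hecke characters
congruent to `1 (mod 9)`. -/
def memF₃ (q : Eis) : Prop :=
  ∃ q₁ q₂ : Eis, (3 : Eis) ∣ (q₁ - 1) ∧ (3 : Eis) ∣ (q₂ - 1) ∧ Squarefree (q₁ * q₂) ∧
    NmN (q₁ * q₂ ^ 2) % 9 = 1 ∧ q = q₁ * q₂ ^ 2 ∧ (9 : Eis) ∣ (q - 1) ∧ q ≠ 1

/-- `ψ_α(r, s) = ∑_{c ≡ 1 (3), (c, α) = 1} g₃(r, c) N(c)^{-s}`. -/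
def ψa (χ : Eis → Eis → Eis) (α r : Eis) (s : ℂ) : ℂ :=
  ∑' c : {c : Eis // (3 : Eis) ∣ (c - 1) ∧ IsCoprime c α},
    g₃ χ r c.1 * (Nm c.1 : ℂ) ^ (-s)

/-- `ψ(r, s) = ∑_{c ≡ 1 (3)} g₃(r, c) N(c)^{-s}`. -/
def ψ₀ (χ : Eis → Eis → Eis) (r : Eis) (s : ℂ) : ℂ :=
  ∑' c : {c : Eis // (3 : Eis) ∣ (c - 1)}, g₃ χ r c.1 * (Nm c.1 : ℂ) ^ (-s)

/-- `Δ_α(s) = ∏_{π ≡ 1 (3) prime, π ∣ α} (1 - N(π)^{2-3s})`. -/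
def Δprod (α : Eis) (s : ℂ) : ℂ :=
  ∏ᶠ π ∈ {p : Eis | Prime p ∧ (3 : Eis) ∣ (p - 1) ∧ p ∣ α},
    (1 - (Nm π : ℂ) ^ ((2 : ℂ) - 3 * s))

/-- `Ψ` is the (unique) continuation of `ψ(r, ·)` to the strip `1 < Re(s) < 2`,
holomorphic away from `s = 4/3`. -/
def IsPsiContinuation (χ : Eis → Eis → Eis) (r : Eis) (Ψ : ℂ → ℂ) : Prop :=
  (∀ s : ℂ, 1 < s.re → s.re < 2 → s ≠ 4/3 → DifferentiableAt ℂ Ψ s) ∧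
  (∀ s : ℂ, 3/2 < s.re → s.re < 2 → Ψ s = ψ₀ χ r s)


lemma ωc_re : ωc.re = -1/2 := by
  unfold ωc
  have h : (2 * Real.pi * Complex.I / 3 : ℂ) = ((2 * Real.pi / 3 : ℝ) : ℂ) * Complex.I := by
    push_cast; ring
  rw [h, Complex.exp_ofReal_mul_I_re]
  have h2 : (2 * Real.pi / 3 : ℝ) = Real.pi - Real.pi / 3 := by ring
  rw [h2, Real.cos_pi_sub, Real.cos_pi_div_three]; norm_num

lemma ωc_im : ωc.im = Real.sqrt 3 / 2 := by
  unfold ωc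
  have h : (2 * Real.pi * Complex.I / 3 : ℂ) = ((2 * Real.pi / 3 : ℝ) : ℂ) * Complex.I := by
    push_cast; ring
  rw [h, Complex.exp_ofReal_mul_I_im]
  have h2 : (2 * Real.pi / 3 : ℝ) = Real.pi - Real.pi / 3 := by ring
  rw [h2, Real.sin_pi_sub, Real.sin_pi_div_three]

lemma ωc_sq : ωc * ωc = -1 - ωc := by
  have h3 : Real.sqrt 3 * Real.sqrt 3 = 3 := Real.mul_self_sqrt (by norm_num)
  apply Complex.ext
  · simp [ωc_re, ωc_im]; nlinarith
  · simp [ωc_re, ωc_im]; ring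

lemma ωc_conj : (starRingEnd ℂ) ωc = -1 - ωc := by
  apply Complex.ext
  · simp [ωc_re]; norm_num
  · simp [ωc_im]

lemma exists_coords (x : Eis) : ∃ p : ℤ × ℤ, (x : ℂ) = p.1 + p.2 * ωc := by
  obtain ⟨x, hx⟩ := x
  change ∃ p : ℤ × ℤ, x = p.1 + p.2 * ωc
  unfold Eis at hx
  induction hx using Subring.closure_induction with
  | mem x hx => exact ⟨(0, 1), by simp at hx; simp [hx]⟩
  | zero => exact ⟨(0, 0), by simp⟩
  | one => exact ⟨(1, 0), by simp⟩
  | add x y _ _ hx hy =>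
    obtain ⟨p, rfl⟩ := hx
    obtain ⟨q, rfl⟩ := hy
    exact ⟨(p.1 + q.1, p.2 + q.2), by push_cast; ring⟩
  | neg x _ hx =>
    obtain ⟨p, rfl⟩ := hx
    exact ⟨(-p.1, -p.2), by push_cast; ring⟩
  | mul x y _ _ hx hy =>
    obtain ⟨p, rfl⟩ := hx
    obtain ⟨q, rfl⟩ := hy
    refine ⟨(p.1 * q.1 - p.2 * q.2, p.1 * q.2 + p.2 * q.1 - p.2 * q.2), ?_⟩
    push_cast
    linear_combination (p.2 * q.2 : ℂ) * ωc_sq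

/-- Integer coordinates. -/
def crd (x : Eis) : ℤ × ℤ := (exists_coords x).choose

lemma crd_spec (x : Eis) : (x : ℂ) = (crd x).1 + (crd x).2 * ωc := (exists_coords x).choose_spec

lemma crd_inj : Function.Injective crd := by
  intro x y h
  apply Subtype.ext
  rw [crd_spec x, crd_spec y, h]

lemma Nm_crd (x : Eis) :
    Nm x = (((crd x).1 ^ 2 - (crd x).1 * (crd x).2 + (crd x).2 ^ 2 : ℤ) : ℝ) := by
  have h3 : Real.sqrt 3 * Real.sqrt 3 = 3 := Real.mul_self_sqrt (by norm_num)
  unfold Nm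
  rw [crd_spec x, Complex.normSq_apply]
  simp [ωc_re, ωc_im]
  linear_combination ((crd x).2 ^ 2 / 4 : ℝ) * h3

lemma Nm_mul (x y : Eis) : Nm (x * y) = Nm x * Nm y := by simp [Nm]

lemma Nm_pow (x : Eis) (k : ℕ) : Nm (x ^ k) = Nm x ^ k := by simp [Nm]

lemma Nm_one : Nm 1 = 1 := by simp [Nm]

lemma Nm_nonneg (x : Eis) : 0 ≤ Nm x := Complex.normSq_nonneg _

lemma Nm_pos {x : Eis} (h : x ≠ 0) : 0 < Nm x := by
  unfold Nm
  rw [Complex.normSq_pos]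
  simpa using h

lemma Nm_int (x : Eis) : ∃ n : ℕ, Nm x = n := by
  have h := Nm_crd x
  have h0 := Nm_nonneg x
  rw [h] at h0
  have h1 : (0 : ℤ) ≤ (crd x).1 ^ 2 - (crd x).1 * (crd x).2 + (crd x).2 ^ 2 := by exact_mod_cast h0
  obtain ⟨n, hn⟩ := Int.eq_ofNat_of_zero_le h1
  exact ⟨n, by rw [h, hn]; simp⟩

lemma Nm_eq (x : Eis) : Nm x = NmN x := by
  obtain ⟨n, hn⟩ := Nm_int x
  simp [NmN, hn]

lemma one_le_Nm {x : Eis} (h : x ≠ 0) : 1 ≤ Nm x := by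
  have := Nm_pos h
  rw [Nm_eq] at *
  exact_mod_cast this

lemma isUnit_of_Nm {x : Eis} (h : Nm x = 1) : IsUnit x := by
  have hω : ωc ∈ Eis := Subring.subset_closure (Set.mem_singleton _)
  have hc : (starRingEnd ℂ) (x : ℂ) ∈ Eis := by
    rw [crd_spec x]
    simp only [map_add, map_mul, ωc_conj, map_intCast]
    exact add_mem (intCast_mem _ _) (mul_mem (intCast_mem _ _)
      (sub_mem (neg_mem (one_mem _)) hω))
  refine IsUnit.of_mul_eq_one ⟨_, hc⟩ ?_
  apply Subtype.ext
  change (x : ℂ) * (starRingEnd ℂ) (x : ℂ) = 1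
  rw [Complex.mul_conj]
  unfold Nm at h
  rw [h]; simp

/-- Nonzero elements of bounded norm. -/
def Bl (X : ℝ) : Set Eis := {e | e ≠ 0 ∧ Nm e ≤ X}

lemma Bl_bound (X : ℝ) (hX : 0 ≤ X) : (Bl X).Finite ∧ ((Bl X).ncard : ℝ) ≤ 25 * X := by
  by_cases h1 : 1 ≤ X
  swap
  · have : Bl X = ∅ := by
      ext e
      simp only [Bl, Set.mem_ofPred_eq, Set.mem_empty_iff_false, iff_false, not_and]
      intro he
      have := one_le_Nm he
      linarith
    rw [this]
    simp; exact hX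
  set s := Real.sqrt X with hs
  have hs2 : s * s = X := Real.mul_self_sqrt hX
  have hs1 : 1 ≤ s := by rw [hs]; exact Real.one_le_sqrt.mpr h1
  set M : ℤ := ⌊2 * s⌋ with hM
  have hMs : (M : ℝ) ≤ 2 * s := Int.floor_le _
  have hM0 : 0 ≤ M := Int.floor_nonneg.mpr (by linarith)
  set F : Finset (ℤ × ℤ) := Finset.Icc (-M) M ×ˢ Finset.Icc (-M) M with hF
  have key : ∀ a b : ℝ, a ^ 2 - a * b + b ^ 2 ≤ X → |a| ≤ 2 * s := by
    intro a b h
    apply abs_le_of_sq_le_sq _ (by linarith)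
    nlinarith [sq_nonneg (a - 2 * b)]
  have hmaps : ∀ e ∈ Bl X, crd e ∈ (F : Set (ℤ × ℤ)) := by
    intro e he
    have h := he.2
    rw [Nm_crd] at h
    push_cast at h
    have ha := abs_le.mp (key _ _ h)
    have hb := abs_le.mp (key (crd e).2 (crd e).1 (by linarith))
    simp only [hF, Finset.coe_product, Finset.coe_Icc, Set.mem_prod, Set.mem_Icc]
    have l1 : ∀ z : ℤ, (z : ℝ) ≤ 2 * s → z ≤ M := fun z hz => Int.le_floor.mpr hz
    have l2 : ∀ z : ℤ, -(2 * s) ≤ (z : ℝ) → -M ≤ z := by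
      intro z hz
      have := l1 (-z) (by push_cast; linarith)
      linarith
    exact ⟨⟨l2 _ ha.1, l1 _ ha.2⟩, ⟨l2 _ hb.1, l1 _ hb.2⟩⟩
  have hfin : (Bl X).Finite :=
    Set.Finite.of_injOn (f := crd) (t := (F : Set (ℤ × ℤ))) hmaps crd_inj.injOn F.finite_toSet
  refine ⟨hfin, ?_⟩
  have hc := Set.ncard_le_ncard_of_injOn crd hmaps crd_inj.injOn F.finite_toSet
  rw [Set.ncard_coe_finset] at hc
  have hcard : (F.card : ℝ) = (2 * M + 1) ^ 2 := by
    rw [hF, Finset.card_product, Int.card_Icc]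
    have : (((M + 1 - -M).toNat : ℤ)) = 2 * M + 1 := by
      rw [Int.toNat_of_nonneg (by linarith)]; ring
    have h' : (((M + 1 - -M).toNat : ℝ)) = 2 * M + 1 := by exact_mod_cast this
    push_cast
    rw [h']; ring
  have hM0' : (0 : ℝ) ≤ M := by exact_mod_cast hM0
  calc ((Bl X).ncard : ℝ) ≤ F.card := by exact_mod_cast hc
    _ = (2 * M + 1) ^ 2 := hcard
    _ ≤ (5 * s) ^ 2 := by
      apply pow_le_pow_left₀ (by linarith); linarith
    _ = 25 * X := by rw [← hs2]; ring

/-- Divisors. -/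
def Dv (g : Eis) : Set Eis := {d | d ∣ g}

lemma Nm_le_of_dvd {d g : Eis} (hg : g ≠ 0) (h : d ∣ g) : Nm d ≤ Nm g := by
  obtain ⟨e, rfl⟩ := h
  rw [Nm_mul]
  have := one_le_Nm (right_ne_zero_of_mul hg)
  nlinarith [Nm_nonneg d]

lemma Dv_sub {g : Eis} (hg : g ≠ 0) : Dv g ⊆ Bl (Nm g) := by
  intro d hd
  exact ⟨ne_zero_of_dvd_ne_zero hg hd, Nm_le_of_dvd hg hd⟩

lemma Dv_fin {g : Eis} (hg : g ≠ 0) : (Dv g).Finite :=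
  (Bl_bound _ (Nm_nonneg g)).1.subset (Dv_sub hg)

/-- Small prime divisors. -/
def Sm (P : ℝ) (g : Eis) : Set Eis := {p | Prime p ∧ p ∣ g ∧ Nm p ≤ P}

lemma Sm_sub (P : ℝ) (g : Eis) : Sm P g ⊆ Bl P := fun _ hp => ⟨hp.1.ne_zero, hp.2.2⟩

lemma Sm_fin {P : ℝ} (hP : 0 ≤ P) (g : Eis) : (Sm P g).Finite :=
  (Bl_bound _ hP).1.subset (Sm_sub P g)

lemma exists_irred {g : Eis} (hg : g ≠ 0) (h : ∃ d, d ∣ g ∧ Nm d ≠ 1) :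
    ∃ p, p ∣ g ∧ Irreducible p := by
  have hex : ∃ n : ℕ, ∃ d, d ∣ g ∧ Nm d ≠ 1 ∧ NmN d = n := by
    obtain ⟨d, h1, h2⟩ := h
    exact ⟨_, d, h1, h2, rfl⟩
  classical
  obtain ⟨p, hp, hp1, hpn⟩ := Nat.find_spec hex
  have hmin : ∀ d, d ∣ g → Nm d ≠ 1 → Nm p ≤ Nm d := by
    intro d hd hd1
    rw [Nm_eq p, Nm_eq d, hpn]
    exact_mod_cast Nat.find_min' hex ⟨d, hd, hd1, rfl⟩
  have hp0 : p ≠ 0 := ne_zero_of_dvd_ne_zero hg hp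
  refine ⟨p, hp, ?_, ?_⟩
  · intro hu
    apply hp1
    have := Nm_le_of_dvd one_ne_zero hu.dvd
    rw [Nm_one] at this
    exact le_antisymm this (one_le_Nm hp0)
  · intro a b hab
    by_cases ha : Nm a = 1
    · exact Or.inl (isUnit_of_Nm ha)
    · right
      apply isUnit_of_Nm
      have h1 := hmin a ((Dvd.intro _ hab.symm).trans hp) ha
      have ha0 : a ≠ 0 := by rintro rfl; simp at hab; exact hp0 hab
      have hb0 : b ≠ 0 := by rintro rfl; simp at hab; exact hp0 hab
      have h2 := one_le_Nm ha0
      have h3 := one_le_Nm hb0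
      rw [hab, Nm_mul] at h1
      nlinarith

lemma two_le_Nm {p : Eis} (hp : Prime p) : 2 ≤ Nm p := by
  have h1 := one_le_Nm hp.ne_zero
  have h2 : Nm p ≠ 1 := fun h => hp.not_isUnit (isUnit_of_Nm h)
  rw [Nm_eq] at *
  have h1' : 1 ≤ NmN p := by exact_mod_cast h1
  have h2' : NmN p ≠ 1 := by exact_mod_cast h2
  have : 2 ≤ NmN p := by omega
  exact_mod_cast this

lemma finMult {p g : Eis} (hp : Prime p) (hg : g ≠ 0) : FiniteMultiplicity p g := by
  obtain ⟨n, hn⟩ := pow_unbounded_of_one_lt (Nm g) (one_lt_two)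
  refine ⟨n, fun h => ?_⟩
  have h1 := Nm_le_of_dvd hg ((pow_dvd_pow p (Nat.le_succ n)).trans h)
  rw [Nm_pow] at h1
  have := pow_le_pow_left₀ (by norm_num) (two_le_Nm hp) n
  linarith

lemma Dv_mul {p h : Eis} (hp : Prime p) (hh : h ≠ 0) (k : ℕ) :
    (Dv (p ^ k * h)).ncard ≤ (k + 1) * (Dv h).ncard := by
  classical
  have hfin := Dv_fin hh
  have hg : p ^ k * h ≠ 0 := mul_ne_zero (pow_ne_zero _ hp.ne_zero) hh
  set F := Finset.range (k + 1) ×ˢ hfin.toFinset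
  have hsub : Dv (p ^ k * h) ⊆ ((F.image fun q => p ^ q.1 * q.2 : Finset Eis) : Set Eis) := by
    intro d hd
    have hd0 : d ≠ 0 := ne_zero_of_dvd_ne_zero hg hd
    change d ∣ _ at hd
    obtain ⟨e, f, he, hf, hef⟩ : ∃ e f, e ∣ p ^ k ∧ f ∣ h ∧ d = e * f := by
      obtain ⟨d', hdd, hd'⟩ := (finMult hp hd0).exists_eq_pow_mul_and_not_dvd
      generalize multiplicity p d = j at hdd
      subst hdd
      by_cases hjk : j ≤ k
      · refine ⟨p ^ j, d', pow_dvd_pow _ hjk, ?_, rfl⟩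
        obtain ⟨i, rfl⟩ := Nat.exists_eq_add_of_le hjk
        rw [pow_add, mul_assoc] at hd
        have h2 := (mul_dvd_mul_iff_left (pow_ne_zero _ hp.ne_zero)).mp hd
        obtain ⟨x, hx⟩ := h2
        have : p ^ i ∣ x := hp.pow_dvd_of_dvd_mul_left i hd' (Dvd.intro _ hx)
        obtain ⟨y, rfl⟩ := this
        refine ⟨y, ?_⟩
        apply mul_left_cancel₀ (pow_ne_zero i hp.ne_zero)
        rw [hx]; ring
      · obtain ⟨i, rfl⟩ := Nat.exists_eq_add_of_le (not_le.mp hjk).le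
        refine ⟨p ^ k, p ^ i * d', dvd_rfl, ?_, by rw [pow_add, mul_assoc]⟩
        rw [pow_add, mul_assoc] at hd
        exact (mul_dvd_mul_iff_left (pow_ne_zero _ hp.ne_zero)).mp hd
    obtain ⟨j, hj, hu⟩ := (dvd_prime_pow hp k).mp he
    obtain ⟨u, hu⟩ := hu.symm
    simp only [Finset.coe_image, Set.mem_image]
    refine ⟨(j, u * f), ?_, ?_⟩
    · simp only [F, Finset.coe_product, Set.mem_prod, Finset.mem_coe, Finset.mem_range,
        Set.Finite.mem_toFinset]
      refine ⟨by omega, ?_⟩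
      change _ ∣ h
      exact (Units.mul_left_dvd (u := u)).mpr hf
    · simp only [hef, ← hu]; ring
  calc (Dv (p ^ k * h)).ncard ≤ _ := Set.ncard_le_ncard hsub (Finset.finite_toSet _)
    _ ≤ F.card := by rw [Set.ncard_coe_finset]; exact Finset.card_image_le
    _ = _ := by
      simp only [F, Finset.card_product, Finset.card_range, Set.ncard_eq_toFinset_card _ hfin]

lemma Aineq (ε : ℝ) (hε : 0 < ε) : ∃ A : ℝ, 1 ≤ A ∧ ∀ (k : ℕ) (x : ℝ), 2 ≤ x →
    (k + 1 : ℝ) ≤ A * (x ^ k) ^ ε := by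
  have hl : 0 < ε * Real.log 2 := mul_pos hε (Real.log_pos one_lt_two)
  refine ⟨max 1 (1 / (ε * Real.log 2)), le_max_left _ _, fun k x hx => ?_⟩
  set A := max 1 (1 / (ε * Real.log 2))
  have hA1 : 1 ≤ A := le_max_left _ _
  have hA2 : 1 ≤ A * (ε * Real.log 2) := by
    have : 1 / (ε * Real.log 2) ≤ A := le_max_right _ _
    rwa [div_le_iff₀ hl] at this
  have h1 : ((2 : ℝ) ^ k) ^ ε ≤ (x ^ k) ^ ε :=
    Real.rpow_le_rpow (by positivity) (pow_le_pow_left₀ (by norm_num) hx k) hε.le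
  have h2 : 1 + k * (ε * Real.log 2) ≤ ((2 : ℝ) ^ k) ^ ε := by
    rw [Real.rpow_def_of_pos (by positivity), Real.log_pow]
    have := Real.add_one_le_exp (k * Real.log 2 * ε)
    linarith
  have hk : (0 : ℝ) ≤ k := Nat.cast_nonneg k
  nlinarith

lemma Bineq (ε : ℝ) (hε : 0 < ε) (k : ℕ) (x : ℝ) (hx : (2 : ℝ) ^ (1 / ε) ≤ x) :
    (k + 1 : ℝ) ≤ (x ^ k) ^ ε := by
  have hx0 : 0 ≤ x := le_trans (by positivity) hx
  have h1 : 2 ≤ x ^ ε := by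
    have := Real.rpow_le_rpow (by positivity) hx hε.le
    rwa [← Real.rpow_mul (by norm_num), one_div_mul_cancel hε.ne', Real.rpow_one] at this
  rw [← Real.rpow_natCast, ← Real.rpow_mul hx0, mul_comm, Real.rpow_mul hx0, Real.rpow_natCast]
  have h2 := pow_le_pow_left₀ (by norm_num) h1 k
  have h3 : k + 1 ≤ 2 ^ k := Nat.lt_two_pow_self
  have h4 : (k + 1 : ℝ) ≤ 2 ^ k := by exact_mod_cast h3
  linarith

lemma divisor_bound (hprime : ∀ p : Eis, Irreducible p → Prime p) (ε A : ℝ) (hε : 0 < ε)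
    (hA1 : 1 ≤ A) (hA : ∀ (k : ℕ) (x : ℝ), 2 ≤ x → (k + 1 : ℝ) ≤ A * (x ^ k) ^ ε) (n : ℕ) :
    ∀ g : Eis, g ≠ 0 → NmN g = n →
      ((Dv g).ncard : ℝ) ≤ 25 * A ^ (Sm ((2 : ℝ) ^ (1 / ε)) g).ncard * Nm g ^ ε := by
  induction n using Nat.strong_induction_on with
  | _ n ih =>
  intro g hg hn
  set P := (2 : ℝ) ^ (1 / ε)
  have hP : 0 ≤ P := by positivity
  by_cases hd : ∃ d, d ∣ g ∧ Nm d ≠ 1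
  swap
  · push Not at hd
    have hsub : Dv g ⊆ Bl 1 := fun d h => ⟨ne_zero_of_dvd_ne_zero hg h, (hd d h).le⟩
    have hb := Bl_bound 1 zero_le_one
    have h1 : ((Dv g).ncard : ℝ) ≤ (Bl 1).ncard := by
      exact_mod_cast Set.ncard_le_ncard hsub hb.1
    rw [hd g dvd_rfl, Real.one_rpow]
    have : 1 ≤ A ^ (Sm P g).ncard := one_le_pow₀ hA1
    linarith [hb.2]
  obtain ⟨p, hpg, hirr⟩ := exists_irred hg hd
  have hp := hprime p hirr
  obtain ⟨h, hgk, hph⟩ := (finMult hp hg).exists_eq_pow_mul_and_not_dvd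
  generalize multiplicity p g = k at hgk
  have hh : h ≠ 0 := by rintro rfl; simp at hph
  have hk : k ≠ 0 := by
    rintro rfl
    simp at hgk
    exact hph (hgk ▸ hpg)
  have hN : Nm g = Nm p ^ k * Nm h := by rw [hgk, Nm_mul, Nm_pow]
  have hp2 := two_le_Nm hp
  have hlt : NmN h < n := by
    rw [← hn]
    have : Nm h < Nm g := by
      rw [hN]
      have h1 : (2:ℝ) ≤ Nm p ^ k := by
        calc (2 : ℝ) ≤ Nm p := hp2
          _ ≤ _ := le_self_pow₀ (by linarith) hk
      nlinarith [one_le_Nm hh]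
    rw [Nm_eq, Nm_eq] at this
    exact_mod_cast this
  have hI := ih _ hlt h hh rfl
  have hD : ((Dv g).ncard : ℝ) ≤ (k + 1) * (Dv h).ncard := by
    rw [hgk]; exact_mod_cast Dv_mul hp hh k
  have hrp : Nm g ^ ε = (Nm p ^ k) ^ ε * Nm h ^ ε := by
    rw [hN, Real.mul_rpow (pow_nonneg (Nm_nonneg _) _) (Nm_nonneg _)]
  have hhg : h ∣ g := Dvd.intro_left _ hgk.symm
  have hsub : Sm P h ⊆ Sm P g := fun q hq => ⟨hq.1, hq.2.1.trans hhg, hq.2.2⟩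
  have hk0 : (0 : ℝ) ≤ k + 1 := by positivity
  have hx0 : 0 ≤ (Nm p ^ k) ^ ε := Real.rpow_nonneg (pow_nonneg (Nm_nonneg _) _) _
  have hh0 : 0 ≤ Nm h ^ ε := Real.rpow_nonneg (Nm_nonneg _) _
  have main : (k + 1 : ℝ) * A ^ (Sm P h).ncard ≤ A ^ (Sm P g).ncard * (Nm p ^ k) ^ ε := by
    by_cases hsm : Nm p ≤ P
    · have hlt : (Sm P h).ncard + 1 ≤ (Sm P g).ncard :=
        Set.ncard_lt_ncard (hsub.ssubset_of_mem_notMem (a := p) ⟨hp, hpg, hsm⟩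
          (fun hq => hph hq.2.1)) (Sm_fin hP g)
      have h1 : A ^ ((Sm P h).ncard + 1) ≤ A ^ (Sm P g).ncard := pow_le_pow_right₀ hA1 hlt
      calc (k + 1 : ℝ) * A ^ (Sm P h).ncard
          ≤ (A * (Nm p ^ k) ^ ε) * A ^ (Sm P h).ncard := by
            gcongr; exact hA k _ hp2
        _ = A ^ ((Sm P h).ncard + 1) * (Nm p ^ k) ^ ε := by rw [pow_succ]; ring
        _ ≤ _ := by gcongr
    · have h1 : A ^ (Sm P h).ncard ≤ A ^ (Sm P g).ncard :=
        pow_le_pow_right₀ hA1 (Set.ncard_le_ncard hsub (Sm_fin hP g))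
      rw [mul_comm]
      gcongr
      exact Bineq ε hε k _ (not_le.mp hsm).le
  calc ((Dv g).ncard : ℝ) ≤ (k + 1) * (Dv h).ncard := hD
    _ ≤ (k + 1) * (25 * A ^ (Sm P h).ncard * Nm h ^ ε) := by gcongr
    _ = 25 * ((k + 1) * A ^ (Sm P h).ncard) * Nm h ^ ε := by ring
    _ ≤ 25 * (A ^ (Sm P g).ncard * (Nm p ^ k) ^ ε) * Nm h ^ ε := by gcongr
    _ = _ := by rw [hrp]; ring

lemma ne_zero_of_congr {g : Eis} (h : (3 : Eis) ∣ (g - 1)) : g ≠ 0 := by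
  rintro rfl
  have h1 : (3 : Eis) ∣ 1 := by
    have := (dvd_neg (a := (3 : Eis))).mpr h
    simpa using this
  have := Nm_le_of_dvd one_ne_zero h1
  have h3 : Nm 3 = 9 := by
    simp only [Nm]
    change Complex.normSq 3 = 9
    rw [show (3 : ℂ) = ((3 : ℝ) : ℂ) by norm_num, Complex.normSq_ofReal]; norm_num
  rw [h3, Nm_one] at this
  norm_num at this

/-- Lemma 7.1: for any gcd-function `G` on `ℤ[ω]`,
`∑_{c ≡ 1 (3), C < N(c) ≤ 2C} N((g, c))^Δ N(c)^{-δ} ≪_{δ,ε} N(g)^ε C^{1-δ}`. -/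
theorem gcd_dyadic_sum_bound (δ ε : ℝ) (hε : 0 < ε) :
    ∃ C0 : ℝ, ∀ G : Eis → Eis → Eis,
      (∀ g c : Eis, G g c ∣ g ∧ G g c ∣ c ∧ ∀ d : Eis, d ∣ g → d ∣ c → d ∣ G g c) →
      ∀ Cr : ℝ, 1/2 ≤ Cr → ∀ Δ : ℝ, 0 ≤ Δ → Δ ≤ 1 →
      ∀ g : Eis, (3 : Eis) ∣ (g - 1) →
        (∑ᶠ c ∈ {c : Eis | (3 : Eis) ∣ (c - 1) ∧ Cr < Nm c ∧ Nm c ≤ 2 * Cr},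
            Nm (G g c) ^ Δ * Nm c ^ (-δ))
          ≤ C0 * Nm g ^ ε * Cr ^ (1 - δ) := by
  classical
  obtain ⟨A, hA1, hA⟩ := Aineq ε hε
  set P := (2 : ℝ) ^ (1 / ε) with hPdef
  have hP : 0 ≤ P := by positivity
  refine ⟨(1 + 2 ^ (-δ)) * 50 * (25 * A ^ (Bl P).ncard), ?_⟩
  intro G hG Cr hCr Δ hΔ0 hΔ1 g hg3
  have hg : g ≠ 0 := ne_zero_of_congr hg3
  have hC0 : 0 < Cr := by linarith
  have hprime : ∀ p : Eis, Irreducible p → Prime p := by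
    letI : GCDMonoid Eis := gcdMonoidOfGCD G (fun a b => (hG a b).1) (fun a b => (hG a b).2.1)
      (fun {a b c} hac hab => (hG c b).2.2 a hac hab)
    intro p hp
    exact hp.prime
  have hτ : ((Dv g).ncard : ℝ) ≤ 25 * A ^ (Bl P).ncard * Nm g ^ ε := by
    refine (divisor_bound hprime ε A hε hA1 hA _ g hg rfl).trans ?_
    have := Real.rpow_nonneg (Nm_nonneg g) ε
    gcongr
    · exact (Bl_bound P hP).1
    · exact Sm_sub _ _
  set T := {c : Eis | (3 : Eis) ∣ (c - 1) ∧ Cr < Nm c ∧ Nm c ≤ 2 * Cr} with hT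
  have hTfin : T.Finite := (Bl_bound (2 * Cr) (by linarith)).1.subset
    (fun c hc => ⟨ne_zero_of_congr hc.1, hc.2.2⟩)
  rw [finsum_mem_eq_finite_toFinset_sum _ hTfin]
  set F := hTfin.toFinset
  set D := (Dv_fin hg).toFinset
  have h2δ : (0 : ℝ) < 2 ^ (-δ) := by positivity
  have hCδ : 0 < Cr ^ (-δ) := by positivity
  have hterm : ∀ c ∈ F, Nm (G g c) ^ Δ * Nm c ^ (-δ) ≤
      Nm (G g c) * ((1 + 2 ^ (-δ)) * Cr ^ (-δ)) := by
    intro c hc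
    have hc' : c ∈ T := hTfin.mem_toFinset.mp hc
    obtain ⟨h1, h2, h3⟩ := hc'
    have hG1 : 1 ≤ Nm (G g c) := one_le_Nm (ne_zero_of_dvd_ne_zero hg (hG g c).1)
    have e1 : Nm (G g c) ^ Δ ≤ Nm (G g c) := by
      calc _ ≤ Nm (G g c) ^ (1 : ℝ) := Real.rpow_le_rpow_of_exponent_le hG1 hΔ1
        _ = _ := Real.rpow_one _
    have e2 : Nm c ^ (-δ) ≤ (1 + 2 ^ (-δ)) * Cr ^ (-δ) := by
      rcases le_total 0 δ with hδ | hδ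
      · have := Real.rpow_le_rpow_of_nonpos hC0 h2.le (neg_nonpos.mpr hδ)
        nlinarith
      · have := Real.rpow_le_rpow (Nm_nonneg c) h3 (neg_nonneg.mpr hδ)
        rw [Real.mul_rpow (by norm_num) hC0.le] at this
        nlinarith
    exact mul_le_mul e1 e2 (Real.rpow_nonneg (Nm_nonneg c) _) (Nm_nonneg _)
  have hmaps : ∀ c ∈ F, G g c ∈ D := fun c _ => (Dv_fin hg).mem_toFinset.mpr (hG g c).1
  have hfib : ∀ d ∈ D, ∑ c ∈ F with G g c = d, Nm (G g c) ≤ 50 * Cr := by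
    intro d hd
    have hdg : d ∣ g := (Dv_fin hg).mem_toFinset.mp hd
    have hd0 : d ≠ 0 := ne_zero_of_dvd_ne_zero hg hdg
    have hdp := Nm_pos hd0
    have hX : 0 ≤ 2 * Cr / Nm d := by positivity
    obtain ⟨hBf, hBc⟩ := Bl_bound _ hX
    have hsub : (F.filter fun c => G g c = d) ⊆ hBf.toFinset.image (fun e => d * e) := by
      intro c hc
      rw [Finset.mem_filter] at hc
      have hcT : c ∈ T := hTfin.mem_toFinset.mp hc.1
      have hdc : d ∣ c := hc.2 ▸ (hG g c).2.1
      obtain ⟨e, rfl⟩ := hdc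
      refine Finset.mem_image.mpr ⟨e, hBf.mem_toFinset.mpr ⟨?_, ?_⟩, rfl⟩
      · exact right_ne_zero_of_mul (ne_zero_of_congr hcT.1)
      · rw [le_div_iff₀ hdp, mul_comm, ← Nm_mul]; exact hcT.2.2
    have hcard : ((F.filter fun c => G g c = d).card : ℝ) ≤ 25 * (2 * Cr / Nm d) := by
      refine le_trans ?_ hBc
      rw [Set.ncard_eq_toFinset_card _ hBf]
      exact_mod_cast (Finset.card_le_card hsub).trans Finset.card_image_le
    calc ∑ c ∈ F with G g c = d, Nm (G g c) = ∑ c ∈ F with G g c = d, Nm d :=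
          Finset.sum_congr rfl (fun c hc => by rw [(Finset.mem_filter.mp hc).2])
      _ = (F.filter fun c => G g c = d).card * Nm d := by simp
      _ ≤ 25 * (2 * Cr / Nm d) * Nm d := by gcongr
      _ = 50 * Cr := by field_simp; norm_num
  have hsum : ∑ c ∈ F, Nm (G g c) ≤ (Dv g).ncard * (50 * Cr) := by
    rw [← Finset.sum_fiberwise_of_maps_to hmaps]
    refine (Finset.sum_le_sum hfib).trans ?_
    rw [Finset.sum_const, nsmul_eq_mul, Set.ncard_eq_toFinset_card _ (Dv_fin hg)]
  calc ∑ c ∈ F, Nm (G g c) ^ Δ * Nm c ^ (-δ)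
      ≤ ∑ c ∈ F, Nm (G g c) * ((1 + 2 ^ (-δ)) * Cr ^ (-δ)) := Finset.sum_le_sum hterm
    _ = (∑ c ∈ F, Nm (G g c)) * ((1 + 2 ^ (-δ)) * Cr ^ (-δ)) := by rw [Finset.sum_mul]
    _ ≤ ((25 * A ^ (Bl P).ncard * Nm g ^ ε) * (50 * Cr)) * ((1 + 2 ^ (-δ)) * Cr ^ (-δ)) := by
      refine mul_le_mul_of_nonneg_right (hsum.trans ?_) (by positivity)
      exact mul_le_mul_of_nonneg_right hτ (by positivity)
    _ = (1 + 2 ^ (-δ)) * 50 * (25 * A ^ (Bl P).ncard) * Nm g ^ ε * Cr ^ (1 - δ) := by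
      rw [sub_eq_add_neg, Real.rpow_add hC0, Real.rpow_one]; ring

end CubicPaper
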